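/- Farey counting lower bound: there exists a constant c > 0 such that for any interval I ⊆ [0,1) and any N > 2/|I|, the number of reduced fractions p/q ∈ I with q ≤ N is at least c·|I|·N²/log N. -/

import Mathlib

theorem cb_bound (n : ℕ) (n_large : 2 < n) :
    Nat.centralBinom n ≤ (2 * n) ^ Nat.sqrt (2 * n) * 4 ^ (2 * n / 3) *
      (2 * n) ^ ((Finset.Ioc n (2 * n)).filter Nat.Prime).card := by
  have n_pos : 0 < n := by omega
  have n2_pos : 1 ≤ 2 * n := by omega
  let f : ℕ → ℕ := fun x => x ^ n.centralBinom.factorization x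
  let A := (Finset.range (2 * n / 3 + 1)).filter Nat.Prime
  let B := (Finset.Ioc n (2 * n)).filter Nat.Prime
  have hAB : Disjoint A B := by
    rw [Finset.disjoint_left]
    intro x hx hy
    simp only [A, B, Finset.mem_filter, Finset.mem_range, Finset.mem_Ioc] at hx hy
    omega
  have hprod : ∏ x ∈ A ∪ B, f x = n.centralBinom := by
    refine Eq.trans ?_ n.prod_pow_factorization_centralBinom
    apply Finset.prod_subset
    · intro x hx
      simp only [A, B, Finset.mem_union, Finset.mem_filter, Finset.mem_range,
        Finset.mem_Ioc] at hx ⊢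
      omega
    · intro x hx h2x
      simp only [A, B, Finset.mem_union, Finset.mem_filter, Finset.mem_range,
        Finset.mem_Ioc] at hx h2x
      by_cases hp : x.Prime
      · simp only [hp, and_true] at h2x
        dsimp only [f]
        rw [Nat.factorization_centralBinom_of_two_mul_self_lt_three_mul n_large
          (by omega) (by omega), pow_zero]
      · dsimp only [f]
        rw [Nat.factorization_eq_zero_of_not_prime n.centralBinom hp, pow_zero]
  have hle : ∀ p, f p ≤ 2 * n := fun p =>
    Nat.pow_factorization_choose_le (by omega)
  rw [← hprod, Finset.prod_union hAB]
  apply mul_le_mul'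
  · rw [← Finset.prod_filter_mul_prod_filter_not A (· ≤ Nat.sqrt (2 * n))]
    apply mul_le_mul'
    · refine (Finset.prod_le_prod' fun p _ => hle p).trans ?_
      have : (Finset.Icc 1 (Nat.sqrt (2 * n))).card = Nat.sqrt (2 * n) := by
        rw [Nat.card_Icc, Nat.add_sub_cancel]
      rw [Finset.prod_const]
      refine pow_right_mono₀ n2_pos ((Finset.card_le_card fun x hx => ?_).trans this.le)
      obtain ⟨h1, h2⟩ := Finset.mem_filter.1 hx
      exact Finset.mem_Icc.mpr ⟨(Finset.mem_filter.1 h1).2.one_lt.le, h2⟩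
    · refine le_trans ?_ (primorial_le_four_pow (2 * n / 3))
      refine (Finset.prod_le_prod' fun p hp => (?_ : f p ≤ p)).trans ?_
      · obtain ⟨h1, h2⟩ := Finset.mem_filter.1 hp
        refine (pow_right_mono₀ (Finset.mem_filter.1 h1).2.one_lt.le ?_).trans (pow_one p).le
        exact Nat.factorization_choose_le_one (Nat.sqrt_lt'.mp <| not_le.1 h2)
      refine Finset.prod_le_prod_of_subset_of_one_le' (Finset.filter_subset _ _) ?_
      exact fun p hp _ => (Finset.mem_filter.1 hp).2.one_lt.le
  · refine (Finset.prod_le_prod' fun p _ => hle p).trans ?_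
    rw [Finset.prod_const]

theorem primes_bound : ∃ c : ℝ, 0 < c ∧ ∀ n : ℕ, 1 ≤ n →
    c * n ≤ (((Finset.Ioc n (2 * n)).filter Nat.Prime).card : ℝ) * Real.log (2 * n) := by
  have h1 := (isLittleO_log_rpow_atTop (show (0:ℝ) < 1/2 by norm_num)).bound
    (show (0:ℝ) < 1/20 by norm_num)
  obtain ⟨X, hX⟩ := Filter.eventually_atTop.1 h1
  obtain ⟨M, hM⟩ := exists_nat_ge X
  set K : ℕ := max M 4 with hK
  have hK4 : 4 ≤ K := le_max_right _ _
  have hKM : M ≤ K := le_max_left _ _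
  have hK0 : (0:ℝ) < K := by exact_mod_cast (by omega : 0 < K)
  refine ⟨min (1/5) (Real.log 2 / K), lt_min (by norm_num)
    (div_pos (Real.log_pos (by norm_num)) hK0), fun n hn => ?_⟩
  have hn1 : (1:ℝ) ≤ n := by exact_mod_cast hn
  rcases le_or_gt K n with h | h
  · refine le_trans (mul_le_mul_of_nonneg_right (min_le_left _ _) (by positivity)) ?_
    have hcb := cb_bound n (by omega)
    have h4 := Nat.four_pow_lt_mul_centralBinom n (by omega)
    set P := ((Finset.Ioc n (2 * n)).filter Nat.Prime).card
    have h5 : 4 ^ n ≤ (2 * n) * ((2 * n) ^ Nat.sqrt (2 * n) * 4 ^ (2 * n / 3) * (2 * n) ^ P) :=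
      h4.le.trans (Nat.mul_le_mul (by omega) hcb)
    have h6 : (4:ℝ) ^ n ≤ (2 * n) * ((2 * n) ^ Nat.sqrt (2 * n) * 4 ^ (2 * n / 3) * (2 * n) ^ P) := by
      exact_mod_cast h5
    have h7 := Real.log_le_log (by positivity) h6
    have hne : (2 * (n:ℝ)) ≠ 0 := by positivity
    rw [Real.log_mul hne (by positivity),
      Real.log_mul (mul_ne_zero (pow_ne_zero _ hne) (by positivity)) (pow_ne_zero _ hne),
      Real.log_mul (pow_ne_zero _ hne) (by positivity), Real.log_pow, Real.log_pow, Real.log_pow,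
      Real.log_pow] at h7
    have hL : 0 ≤ Real.log (2 * n) := Real.log_nonneg (by linarith)
    have h8 : Real.log (2 * n) ≤ 1/20 * √(2 * n) := by
      have := hX (2 * n) (by
        have : (M:ℝ) ≤ n := by exact_mod_cast hKM.trans h
        linarith)
      rw [Real.norm_of_nonneg hL, Real.norm_of_nonneg (by positivity), ← Real.sqrt_eq_rpow] at this
      exact this
    have hs : (Nat.sqrt (2 * n) : ℝ) ≤ √(2 * n) := by
      have := @Real.nat_sqrt_le_real_sqrt (2 * n)
      push_cast at this
      exact this
    have hs1 : 1 ≤ √(2 * (n:ℝ)) := Real.one_le_sqrt.2 (by linarith)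
    have hss : √(2 * (n:ℝ)) * √(2 * (n:ℝ)) = 2 * n := Real.mul_self_sqrt (by positivity)
    have hd : ((2 * n / 3 : ℕ) : ℝ) ≤ 2 * n / 3 := by
      have := @Nat.cast_div_le ℝ _ _ _ (2 * n) 3
      push_cast at this
      exact this
    have hl4 : (1.38:ℝ) ≤ Real.log 4 := by
      have : Real.log 4 = 2 * Real.log 2 := by
        rw [show (4:ℝ) = 2 ^ 2 by norm_num, Real.log_pow]; norm_num
      have := Real.log_two_gt_d9
      linarith
    have e1 : (Nat.sqrt (2 * n) : ℝ) * Real.log (2 * n) ≤ 1/20 * (2 * n) := by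
      calc _ ≤ √(2 * n) * (1/20 * √(2 * n)) := mul_le_mul hs h8 hL (by positivity)
        _ = _ := by linear_combination (1/20) * hss
    have e2 : Real.log (2 * n) ≤ 1/20 * (2 * n) := by nlinarith
    have e3 : ((2 * n / 3 : ℕ) : ℝ) * Real.log 4 ≤ 2 * n / 3 * Real.log 4 :=
      mul_le_mul_of_nonneg_right hd (by linarith)
    have e4 : (n:ℝ) * 1.38 ≤ n * Real.log 4 := mul_le_mul_of_nonneg_left hl4 (by positivity)
    linarith
  · refine le_trans (mul_le_mul_of_nonneg_right (min_le_right _ _) (by positivity)) ?_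
    have hnK : (n:ℝ) ≤ K := by exact_mod_cast h.le
    have hl2 : 0 < Real.log 2 := Real.log_pos (by norm_num)
    obtain ⟨p, hp, hp1, hp2⟩ := Nat.exists_prime_lt_and_le_two_mul n (by omega)
    have hc : 1 ≤ ((Finset.Ioc n (2 * n)).filter Nat.Prime).card :=
      Finset.card_pos.2 ⟨p, by simp [hp, hp1, hp2]⟩
    have hc' : (1:ℝ) ≤ (((Finset.Ioc n (2 * n)).filter Nat.Prime).card : ℝ) := by exact_mod_cast hc
    have a1 : Real.log 2 / K * n ≤ Real.log 2 := by
      rw [div_mul_eq_mul_div, div_le_iff₀ hK0]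
      exact mul_le_mul_of_nonneg_left hnK hl2.le
    have a2 : Real.log 2 ≤ Real.log (2 * n) := Real.log_le_log (by norm_num) (by linarith)
    nlinarith

theorem stmt13_fiber (a b : ℝ) (ha : 0 ≤ a) (q : ℕ) (hq : 1 < q * (b - a)) :
    (q : ℝ) * (b - a) / 2 ≤ ((Finset.Ico (max 1 ⌈q * a⌉₊) ⌈q * b⌉₊).card : ℝ) := by
  have hqa : 0 ≤ (q:ℝ) * a := by positivity
  have h1 : (⌈q * a⌉₊ : ℝ) < q * a + 1 := Nat.ceil_lt_add_one hqa
  have h2 : (q : ℝ) * b ≤ (⌈q * b⌉₊ : ℝ) := Nat.le_ceil _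
  set L := max 1 ⌈q * a⌉₊ with hL
  have hLle : (L : ℝ) ≤ q * a + 1 := by
    rw [hL, Nat.cast_max]
    exact max_le (by simpa using hqa) h1.le
  have hlt : L < ⌈q * b⌉₊ := by
    have : (L : ℝ) < ⌈q * b⌉₊ := by nlinarith
    exact_mod_cast this
  rw [Nat.card_Ico, Nat.cast_sub hlt.le]
  have h3 : (L : ℝ) + 1 ≤ ⌈q * b⌉₊ := by exact_mod_cast hlt
  rcases le_or_gt ((q:ℝ) * (b - a)) 2 with h | h
  · linarith
  · nlinarith

/-- Farey counting, lower bound: there is `c > 0` such that for every interval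
`[a, b) ⊆ [0,1)` and every `N > 2/(b−a)`, the number of reduced fractions
`p/q ∈ [a, b)` with `q ≤ N` is at least `c (b−a) N² / log N`. -/
theorem stmt13 :
    ∃ c : ℝ, 0 < c ∧ ∀ a b : ℝ, 0 ≤ a → a < b → b ≤ 1 → ∀ N : ℕ,
      2 / (b - a) < (N : ℝ) →
      c * (b - a) * (N : ℝ) ^ 2 / Real.log N ≤
        (Nat.card {pq : ℕ × ℕ // 1 ≤ pq.2 ∧ pq.2 ≤ N ∧ Nat.gcd pq.1 pq.2 = 1 ∧
          a ≤ (pq.1 : ℝ) / pq.2 ∧ (pq.1 : ℝ) / pq.2 < b} : ℝ) := by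
  obtain ⟨c, hc, hcn⟩ := primes_bound
  refine ⟨c / 12, by positivity, fun a b ha hab hb N hN => ?_⟩
  have hl : 0 < b - a := by linarith
  have hNl : 2 < N * (b - a) := by rwa [div_lt_iff₀ hl] at hN
  have hN2 : (2:ℝ) < N := by nlinarith [(Nat.cast_nonneg N : (0:ℝ) ≤ N)]
  have hN3 : 3 ≤ N := by
    have : 2 < N := by exact_mod_cast hN2
    omega
  have hlog : 0 < Real.log N := Real.log_pos (by linarith)
  obtain ⟨n, hn⟩ : ∃ n, n = N / 2 := ⟨_, rfl⟩
  have hcn' := hcn n (by omega)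
  set Q := (Finset.Ioc n (2 * n)).filter Nat.Prime with hQ
  let S : Finset (Σ _ : ℕ, ℕ) := Q.sigma fun q => Finset.Ico (max 1 ⌈q * a⌉₊) ⌈q * b⌉₊
  have hfin : Set.Finite {pq : ℕ × ℕ | 1 ≤ pq.2 ∧ pq.2 ≤ N ∧ Nat.gcd pq.1 pq.2 = 1 ∧
          a ≤ (pq.1 : ℝ) / pq.2 ∧ (pq.1 : ℝ) / pq.2 < b} := by
    refine Set.Finite.subset (((Finset.range (N + 1)) ×ˢ (Finset.range (N + 1))).finite_toSet) ?_
    rintro ⟨p, q⟩ ⟨h1, h2, -, -, h5⟩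
    simp only at h1 h2 h5
    have hq0 : (0:ℝ) < q := by exact_mod_cast h1
    rw [div_lt_iff₀ hq0] at h5
    have : (p:ℝ) < q := by nlinarith
    have : p < q := by exact_mod_cast this
    simp
    omega
  have hcard : S.card ≤ Nat.card {pq : ℕ × ℕ // 1 ≤ pq.2 ∧ pq.2 ≤ N ∧ Nat.gcd pq.1 pq.2 = 1 ∧
          a ≤ (pq.1 : ℝ) / pq.2 ∧ (pq.1 : ℝ) / pq.2 < b} := by
    have : Finite {pq : ℕ × ℕ // 1 ≤ pq.2 ∧ pq.2 ≤ N ∧ Nat.gcd pq.1 pq.2 = 1 ∧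
          a ≤ (pq.1 : ℝ) / pq.2 ∧ (pq.1 : ℝ) / pq.2 < b} := hfin
    rw [← Nat.card_eq_finsetCard S]
    have key : ∀ x : S, 1 ≤ x.1.1 ∧ x.1.1 ≤ N ∧ Nat.gcd x.1.2 x.1.1 = 1 ∧
        a ≤ (x.1.2 : ℝ) / x.1.1 ∧ (x.1.2 : ℝ) / x.1.1 < b := by
      rintro ⟨⟨q, p⟩, hx⟩
      simp only [S, hQ, Finset.mem_sigma, Finset.mem_filter, Finset.mem_Ioc, Finset.mem_Ico,
        max_le_iff, Nat.ceil_le, Nat.lt_ceil] at hx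
      obtain ⟨⟨⟨h1, h2⟩, hp⟩, ⟨h3, h4⟩, h5⟩ := hx
      have hq0 : (0:ℝ) < q := by exact_mod_cast hp.pos
      have hpq : (p:ℝ) < q := by nlinarith
      have hpq' : p < q := by exact_mod_cast hpq
      refine ⟨hp.one_lt.le, by dsimp only; omega, ?_, ?_, ?_⟩
      · exact (Nat.coprime_of_lt_prime (by omega) hpq' hp).symm
      · rw [le_div_iff₀ hq0]; linarith
      · rw [div_lt_iff₀ hq0]; linarith
    refine Nat.card_le_card_of_injective (fun x : S => ⟨(x.1.2, x.1.1), key x⟩) ?_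
    rintro ⟨⟨q, p⟩, hx⟩ ⟨⟨q', p'⟩, hx'⟩ h
    simp only [Subtype.mk.injEq, Prod.mk.injEq] at h
    obtain ⟨rfl, rfl⟩ := h
    rfl
  have hsum : (Q.card : ℝ) * (N * (b - a) / 4) ≤ S.card := by
    rw [Finset.card_sigma, Nat.cast_sum, ← nsmul_eq_mul]
    refine Finset.card_nsmul_le_sum _ _ _ fun q hq => ?_
    simp only [hQ, Finset.mem_filter, Finset.mem_Ioc] at hq
    have h2q : N ≤ 2 * q := by omega
    have h2q' : (N:ℝ) ≤ 2 * q := by exact_mod_cast h2q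
    refine le_trans ?_ (stmt13_fiber a b ha q (by nlinarith))
    nlinarith
  have hcard' : (S.card : ℝ) ≤ _ := Nat.cast_le.2 hcard
  refine le_trans ?_ hcard'
  refine le_trans ?_ hsum
  have hnN : (2 * n : ℝ) ≤ N := by exact_mod_cast (by omega : 2 * n ≤ N)
  have hnN' : (N : ℝ) ≤ 3 * n := by exact_mod_cast (by omega : N ≤ 3 * n)
  have hn0 : (0:ℝ) < n := by linarith
  have hll : Real.log (2 * n) ≤ Real.log N := Real.log_le_log (by positivity) hnN
  have h9 : c * n ≤ Q.card * Real.log N :=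
    hcn'.trans (mul_le_mul_of_nonneg_left hll (by positivity))
  have h10 : c * N ≤ 3 * (Q.card * Real.log N) := by nlinarith
  rw [div_le_iff₀ hlog]
  have := mul_le_mul_of_nonneg_right h10 (show 0 ≤ (N:ℝ) * (b - a) / 12 by positivity)
  linarith
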